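/- arXiv:1905.03388 — 3 statements merged into one kernel-verified Lean document; each statement's English description precedes it below -/
import Mathlib

section
/- Let n and t be positive integers with 1 ≤ t ≤ 5 and t ≤ (n−1)/2, and let k be a nonnegative integer. Then the integer {k}-domination number of the circulant graph G(n; {1,2,…,t}) equals ⌈kn/(2t+1)⌉. -/
/-- The circulant graph `G(n; D)` on `ℤ_n`: vertices `i ≠ j` are adjacent iff
`min {|i - j|, n - |i - j|} ∈ D`. -/
def circulantGraph (n : ℕ) (D : Finset ℕ) : SimpleGraph (ZMod n) where
  Adj i j := i ≠ j ∧ min (i - j).val (j - i).val ∈ D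
  symm := by
    constructor
    intro i j h
    exact ⟨h.1.symm, by rw [min_comm]; exact h.2⟩
  loopless := by
    constructor
    intro i h
    exact h.1 rfl

instance (n : ℕ) (D : Finset ℕ) : DecidableRel (circulantGraph n D).Adj := fun i j =>
  decidable_of_iff (i ≠ j ∧ min (i - j).val (j - i).val ∈ D) Iff.rfl

/-- `f` is an integer `{k}`-domination function: the sum of `f` over each closed
neighborhood is at least `k`. -/
def IsKDomFun (n : ℕ) [NeZero n] (D : Finset ℕ) (k : ℕ) (f : ZMod n → ℕ) : Prop :=
  ∀ v : ZMod n,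
    k ≤ ∑ u ∈ Finset.univ.filter (fun u => u = v ∨ (circulantGraph n D).Adj v u), f u

/-- The integer `{k}`-domination number `γ_k(G(n; D))`. -/
noncomputable def gammaK (n : ℕ) [NeZero n] (D : Finset ℕ) (k : ℕ) : ℕ :=
  sInf {s | ∃ f : ZMod n → ℕ, IsKDomFun n D k f ∧ s = ∑ v, f v}

/-- In `G(n; {1, …, t})` the closed neighborhood of `v` is the window
`v - t, v - t + 1, …, v + t`. -/
theorem closedNeighborhood_iff_val_le {n t : ℕ} [NeZero n] (h : 2 * t + 1 ≤ n) (u v : ZMod n) :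
    (u = v ∨ (circulantGraph n (Finset.Icc 1 t)).Adj v u) ↔ (u - v + t).val ≤ 2 * t := by
  have hadj : (circulantGraph n (Finset.Icc 1 t)).Adj v u ↔
      v ≠ u ∧ min (v - u).val (u - v).val ∈ Finset.Icc 1 t := Iff.rfl
  rw [hadj, ← neg_sub u v, ← sub_eq_zero, ne_comm, ← sub_ne_zero]
  generalize u - v = d
  have hd : d.val < n := d.val_lt
  rw [ZMod.val_add, ZMod.val_natCast_of_lt (by omega), ZMod.neg_val]
  by_cases h0 : d = 0
  · subst h0
    simp only [true_or, ZMod.val_zero, true_iff, zero_add]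
    rw [Nat.mod_eq_of_lt (by omega)]
    omega
  · have hpos : 0 < d.val := Nat.pos_of_ne_zero ((ZMod.val_ne_zero d).2 h0)
    simp only [h0, false_or, ne_eq, not_false_eq_true, true_and, if_false, Finset.mem_Icc]
    rcases lt_or_ge (d.val + t) n with hlt | hge
    · rw [Nat.mod_eq_of_lt hlt]
      omega
    · rw [Nat.mod_eq_sub_mod hge, Nat.mod_eq_of_lt (by omega)]
      omega

theorem sum_closedNeighborhood {n t : ℕ} [NeZero n] (h : 2 * t + 1 ≤ n) (f : ZMod n → ℕ)
    (v : ZMod n) :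
    ∑ u ∈ Finset.univ.filter
        (fun u => u = v ∨ (circulantGraph n (Finset.Icc 1 t)).Adj v u), f u =
      ∑ j ∈ Finset.range (2 * t + 1), f (v - t + (j : ℕ)) := by
  refine Finset.sum_nbij' (fun u => (u - v + t).val) (fun j => v - t + (j : ℕ)) ?_ ?_ ?_ ?_ ?_
  · intro u hu
    rw [Finset.mem_filter, closedNeighborhood_iff_val_le h] at hu
    exact Finset.mem_range.2 (Nat.lt_succ_of_le hu.2)
  · intro j hj
    have hj' := Finset.mem_range.1 hj
    rw [Finset.mem_filter, closedNeighborhood_iff_val_le h]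
    refine ⟨Finset.mem_univ _, ?_⟩
    rw [show v - t + (j : ZMod n) - v + t = j by ring, ZMod.val_natCast_of_lt (by omega)]
    omega
  · intro u _
    rw [ZMod.natCast_zmod_val]
    ring
  · intro j hj
    have hj' := Finset.mem_range.1 hj
    rw [show v - t + (j : ZMod n) - v + t = j by ring, ZMod.val_natCast_of_lt (by omega)]
  · intro u _
    rw [ZMod.natCast_zmod_val]
    congr 1
    ring

theorem IsKDomFun.mul_le {n t k : ℕ} [NeZero n] (h : 2 * t + 1 ≤ n) {f : ZMod n → ℕ}
    (hf : IsKDomFun n (Finset.Icc 1 t) k f) : k * n ≤ (2 * t + 1) * ∑ v, f v := by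
  calc k * n = ∑ _v : ZMod n, k := by simp [ZMod.card, mul_comm]
    _ ≤ ∑ v : ZMod n, ∑ j ∈ Finset.range (2 * t + 1), f (v - t + (j : ℕ)) :=
      Finset.sum_le_sum fun v _ => sum_closedNeighborhood h f v ▸ hf v
    _ = ∑ j ∈ Finset.range (2 * t + 1), ∑ v : ZMod n, f v := by
      rw [Finset.sum_comm]
      refine Finset.sum_congr rfl fun j _ => ?_
      simp_rw [sub_add]
      exact (Equiv.subRight ((t : ZMod n) - j)).sum_comp f
    _ = (2 * t + 1) * ∑ v, f v := by simp

/-- The balanced distribution of total weight `s` on `ℤ_n`. -/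
def balancedFun (n s : ℕ) (v : ZMod n) : ℕ := (v.val + 1) * s / n - v.val * s / n

theorem balancedFun_natCast (n s m : ℕ) [NeZero n] :
    balancedFun n s (m : ZMod n) = (m + 1) * s / n - m * s / n := by
  have hn : 0 < n := Nat.pos_of_neZero n
  have h (c : ℕ) : (m + c) * s / n = (m % n + c) * s / n + m / n * s := by
    rw [← Nat.add_mul_div_left _ _ hn]
    congr 1
    calc (m + c) * s = (m % n + n * (m / n) + c) * s := by rw [Nat.mod_add_div]
      _ = _ := by ring
  have h0 := h 0
  have h1 := h 1
  simp only [add_zero] at h0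
  rw [balancedFun, ZMod.val_natCast, h0, h1, Nat.add_sub_add_right]

theorem sum_range_balancedFun (n s a l : ℕ) [NeZero n] :
    ∑ j ∈ Finset.range l, balancedFun n s ((a + j : ℕ) : ZMod n) =
      (a + l) * s / n - a * s / n := by
  have hmono : Monotone fun j => (a + j) * s / n := fun i j hij =>
    Nat.div_le_div_right (Nat.mul_le_mul_right s (Nat.add_le_add_left hij a))
  simp_rw [balancedFun_natCast]
  exact Finset.sum_range_tsub hmono l

theorem sum_balancedFun (n s : ℕ) [NeZero n] : ∑ v, balancedFun n s v = s := by
  have hn : 0 < n := Nat.pos_of_neZero n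
  have h := sum_range_balancedFun n s 0 n
  simp only [zero_add, zero_mul, Nat.zero_div, Nat.sub_zero, Nat.mul_div_cancel_left s hn] at h
  refine Eq.trans ?_ h
  refine Finset.sum_nbij' ZMod.val (fun j => (j : ZMod n)) ?_ ?_ ?_ ?_ ?_
  · exact fun v _ => Finset.mem_range.2 v.val_lt
  · exact fun j _ => Finset.mem_univ _
  · exact fun v _ => ZMod.natCast_zmod_val v
  · exact fun j hj => ZMod.val_natCast_of_lt (Finset.mem_range.1 hj)
  · exact fun v _ => by rw [ZMod.natCast_zmod_val]

theorem isKDomFun_balancedFun {n t k s : ℕ} [NeZero n] (h : 2 * t + 1 ≤ n)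
    (hs : k * n ≤ (2 * t + 1) * s) : IsKDomFun n (Finset.Icc 1 t) k (balancedFun n s) := by
  intro v
  have hn : 0 < n := Nat.pos_of_neZero n
  have hsum := sum_range_balancedFun n s (v - t).val (2 * t + 1)
  simp only [Nat.cast_add, ZMod.natCast_zmod_val] at hsum
  rw [sum_closedNeighborhood h, hsum, add_mul]
  have h1 : (v - t).val * s / n + (2 * t + 1) * s / n ≤ ((v - t).val * s + (2 * t + 1) * s) / n :=
    Nat.div_add_div_le_add_div
  have h2 : k ≤ (2 * t + 1) * s / n := (Nat.le_div_iff_mul_le hn).2 hs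
  omega

theorem gammaK_Icc {n t : ℕ} [NeZero n] (h : 2 * t + 1 ≤ n) (k : ℕ) :
    gammaK n (Finset.Icc 1 t) k = ⌈(k * n : ℚ) / (2 * t + 1)⌉₊ := by
  have hceil (s : ℕ) : ⌈(k * n : ℚ) / (2 * t + 1)⌉₊ ≤ s ↔ k * n ≤ (2 * t + 1) * s := by
    rw [Nat.ceil_le, div_le_iff₀' (by positivity)]
    exact_mod_cast Iff.rfl
  refine IsLeast.csInf_eq ⟨⟨balancedFun n _, ?_, (sum_balancedFun n _).symm⟩, ?_⟩
  · exact isKDomFun_balancedFun h ((hceil _).1 le_rfl)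
  · rintro _ ⟨f, hf, rfl⟩
    exact (hceil _).2 (hf.mul_le h)

theorem gammaK_eq_of_t_le_five (n t k : ℕ) [NeZero n] (hn : 0 < n) (ht1 : 1 ≤ t)
    (ht5 : t ≤ 5) (ht2 : t ≤ (n - 1) / 2) :
    gammaK n (Finset.Icc 1 t) k = ⌈(k * n : ℚ) / (2 * t + 1)⌉₊ := by
  exact gammaK_Icc (by omega) k
end

section
/- Let n and t be positive integers with 1 ≤ t ≤ (n−1)/2, and let k be a nonnegative integer. Then the integer {k}-domination number of the circulant graph G(n; {1,2,…,t}) equals ⌈kn/(2t+1)⌉. -/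
theorem min_val_sub_mem_Icc_iff {n t : ℕ} [NeZero n] (ht : 2 * t + 1 ≤ n) (u v : ZMod n) :
    (u = v ∨ v ≠ u ∧ min (v - u).val (u - v).val ∈ Finset.Icc 1 t) ↔
      (u - (v - t)).val < 2 * t + 1 := by
  obtain ⟨d, rfl⟩ : ∃ d, u = v + d := ⟨u - v, by ring⟩
  have hshift : v + d - (v - t) = d + (t : ZMod n) := by ring
  have hneg : v - (v + d) = -d := by ring
  rw [hshift, hneg, add_sub_cancel_left, ZMod.val_add, ZMod.val_natCast_of_lt (by omega),
    ZMod.neg_val, Finset.mem_Icc]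
  have hd : d.val < n := d.val_lt
  by_cases h0 : d = 0
  · subst h0
    simp only [add_zero, ZMod.val_zero, zero_add, true_or, true_iff]
    exact (Nat.mod_le _ _).trans_lt (by omega)
  · have hpos : d.val ≠ 0 := fun h => h0 ((ZMod.val_eq_zero d).1 h)
    have hne : v ≠ v + d := by simpa using h0
    simp only [add_eq_left, h0, false_or, if_false, hne, ne_eq, not_false_eq_true, true_and]
    rcases lt_or_ge (d.val + t) n with h | h
    · rw [Nat.mod_eq_of_lt h]; omega
    · rw [Nat.mod_eq_sub_mod h, Nat.mod_eq_of_lt (by omega)]; omega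

theorem sum_closedNeighborhood_Icc {n t : ℕ} [NeZero n] (ht : 2 * t + 1 ≤ n)
    (f : ZMod n → ℕ) (v : ZMod n) :
    ∑ u ∈ Finset.univ.filter (fun u => u = v ∨ (circulantGraph n (Finset.Icc 1 t)).Adj v u), f u =
      ∑ j ∈ Finset.range (2 * t + 1), f (v - t + j) := by
  refine Finset.sum_bij' (fun u _ => (u - (v - t)).val) (fun j _ => v - t + (j : ZMod n))
    ?_ ?_ ?_ ?_ ?_
  · intro u hu
    exact Finset.mem_range.2 ((min_val_sub_mem_Icc_iff ht u v).1 (Finset.mem_filter.1 hu).2)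
  · intro j hj
    rw [Finset.mem_range] at hj
    refine Finset.mem_filter.2 ⟨Finset.mem_univ _, (min_val_sub_mem_Icc_iff ht _ v).2 ?_⟩
    rwa [add_sub_cancel_left, ZMod.val_natCast_of_lt (by omega)]
  · intro u _
    simp
  · intro j hj
    rw [Finset.mem_range] at hj
    rw [add_sub_cancel_left, ZMod.val_natCast_of_lt (by omega)]
  · intro u _
    simp

theorem IsKDomFun.mul_le_mul_sum {n t k : ℕ} [NeZero n] (ht : 2 * t + 1 ≤ n) {f : ZMod n → ℕ}
    (hf : IsKDomFun n (Finset.Icc 1 t) k f) : k * n ≤ (∑ v, f v) * (2 * t + 1) := by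
  calc k * n = ∑ _v : ZMod n, k := by simp [mul_comm]
    _ ≤ ∑ v : ZMod n, ∑ j ∈ Finset.range (2 * t + 1), f (v - t + j) :=
        Finset.sum_le_sum fun v _ => (hf v).trans_eq (sum_closedNeighborhood_Icc ht f v)
    _ = ∑ j ∈ Finset.range (2 * t + 1), ∑ v : ZMod n, f (v - t + j) := Finset.sum_comm
    _ = ∑ _j ∈ Finset.range (2 * t + 1), ∑ v, f v := by
        refine Finset.sum_congr rfl fun j _ => ?_
        exact Fintype.sum_equiv ((Equiv.subRight (t : ZMod n)).trans (Equiv.addRight (j : ZMod n)))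
          _ _ fun _ => rfl
    _ = (∑ v, f v) * (2 * t + 1) := by simp [mul_comm]

/-- Increments of `i ↦ ⌊i * s / n⌋`: a total weight `s` spread evenly over a period `n`. -/
def evenSpread (n s i : ℕ) : ℕ := (i + 1) * s / n - i * s / n

theorem sum_range_evenSpread (n s a m : ℕ) :
    ∑ j ∈ Finset.range m, evenSpread n s (a + j) = (a + m) * s / n - a * s / n := by
  have hmono : Monotone fun j => (a + j) * s / n := fun i j h => by dsimp only; gcongr
  exact Finset.sum_range_tsub hmono m

theorem evenSpread_periodic {n : ℕ} (hn : 0 < n) (s : ℕ) :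
    Function.Periodic (evenSpread n s) n := by
  intro i
  have h1 : (i + n + 1) * s = (i + 1) * s + n * s := by ring
  have h2 : (i + n) * s = i * s + n * s := by ring
  rw [evenSpread, evenSpread, h1, h2, Nat.add_mul_div_left _ _ hn, Nat.add_mul_div_left _ _ hn,
    Nat.add_sub_add_right]

theorem le_sum_range_evenSpread {n s k m : ℕ} (hn : 0 < n) (h : k * n ≤ s * m) (a : ℕ) :
    k ≤ ∑ j ∈ Finset.range m, evenSpread n s (a + j) := by
  rw [sum_range_evenSpread]
  have h1 : a * s / n + k ≤ (a + m) * s / n := by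
    rw [← Nat.add_mul_div_right _ _ hn]
    exact Nat.div_le_div_right (by nlinarith)
  omega

theorem exists_isKDomFun_sum_eq {n t k s : ℕ} [NeZero n] (ht : 2 * t + 1 ≤ n)
    (hs : k * n ≤ s * (2 * t + 1)) :
    ∃ f : ZMod n → ℕ, IsKDomFun n (Finset.Icc 1 t) k f ∧ s = ∑ v, f v := by
  have hn : 0 < n := NeZero.pos n
  have hcast (x : ℕ) : evenSpread n s (x : ZMod n).val = evenSpread n s x := by
    rw [ZMod.val_natCast, (evenSpread_periodic hn s).map_mod_nat]
  refine ⟨fun v => evenSpread n s v.val, fun v => ?_, ?_⟩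
  · rw [sum_closedNeighborhood_Icc ht]
    refine (le_sum_range_evenSpread hn hs (v - t).val).trans_eq
      (Finset.sum_congr rfl fun j _ => ?_)
    rw [← hcast, Nat.cast_add, ZMod.natCast_zmod_val]
  · calc s = ∑ j ∈ Finset.range n, evenSpread n s (0 + j) := by
          rw [sum_range_evenSpread, zero_add, Nat.mul_div_cancel_left _ hn]; simp
      _ = ∑ v : ZMod n, evenSpread n s v.val := by
          refine Finset.sum_bij' (fun j _ => (j : ZMod n)) (fun v _ => v.val) ?_ ?_ ?_ ?_ ?_
          · simp
          · intro v _
            exact Finset.mem_range.2 v.val_lt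
          · intro j hj
            exact ZMod.val_natCast_of_lt (Finset.mem_range.1 hj)
          · simp
          · intro j _
            rw [hcast, zero_add]

theorem gammaK_eq (n t k : ℕ) [NeZero n] (hn : 0 < n) (ht1 : 1 ≤ t)
    (ht2 : t ≤ (n - 1) / 2) :
    gammaK n (Finset.Icc 1 t) k = ⌈(k * n : ℚ) / (2 * t + 1)⌉₊ := by
  have ht : 2 * t + 1 ≤ n := by omega
  have hceil (s : ℕ) : ⌈(k * n : ℚ) / (2 * t + 1)⌉₊ ≤ s ↔ k * n ≤ s * (2 * t + 1) := by
    rw [Nat.ceil_le, div_le_iff₀ (by positivity)]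
    exact_mod_cast Iff.rfl
  refine IsLeast.csInf_eq ⟨exists_isKDomFun_sum_eq ht ((hceil _).1 le_rfl), ?_⟩
  rintro s ⟨f, hf, rfl⟩
  exact (hceil _).2 (hf.mul_le_mul_sum ht)
end

section
/- Let k be a nonnegative integer and let G = G(8; {1,2}) be the circulant graph on ℤ_8 with difference set {1,2}. Define f on the vertices v_1,…,v_8 (in circular order) by the values (⌊(k+4)/5⌋, ⌊(k+3)/5⌋, ⌊(k+1)/5⌋, ⌊(k+2)/5⌋, ⌊k/5⌋, ⌊(k+4)/5⌋, ⌊(k+3)/5⌋, ⌊(k+1)/5⌋). Then f is an integer {k}-domination function of G and Σ_{v ∈ V(G)} f(v) = ⌈8k/5⌉. -/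
/-- The closed neighborhood of `v` in `G(8; {1, 2})` is the window of five consecutive vertices
centred at `v`. -/
lemma closedNeighborhood_circulantGraph_eight (v : ZMod 8) :
    Finset.univ.filter (fun u => u = v ∨ (circulantGraph 8 {1, 2}).Adj v u) =
      {v - 2, v - 1, v, v + 1, v + 2} := by
  revert v
  decide

lemma sum_closedNeighborhood_circulantGraph_eight (f : ZMod 8 → ℕ) (v : ZMod 8) :
    ∑ u ∈ Finset.univ.filter (fun u => u = v ∨ (circulantGraph 8 {1, 2}).Adj v u), f u =
      f (v - 2) + f (v - 1) + f v + f (v + 1) + f (v + 2) := by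
  have hnodup : ∀ v : ZMod 8, [v - 2, v - 1, v, v + 1, v + 2].Nodup := by decide
  have hset : ({v - 2, v - 1, v, v + 1, v + 2} : Finset (ZMod 8)) =
      [v - 2, v - 1, v, v + 1, v + 2].toFinset := by simp
  rw [closedNeighborhood_circulantGraph_eight, hset, List.sum_toFinset f (hnodup v)]
  simp [add_assoc]

theorem example_n8_t2 (k : ℕ) (f : ZMod 8 → ℕ)
    (hf : ∀ v : ZMod 8,
      f v = (k + [4, 3, 1, 2, 0, 4, 3, 1].getD v.val 0) / 5) :
    IsKDomFun 8 ({1, 2} : Finset ℕ) k f ∧ ∑ v, f v = ⌈(8 * k : ℚ) / 5⌉₊ := by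
  have h0 : f 0 = (k + 4) / 5 := hf 0
  have h1 : f 1 = (k + 3) / 5 := hf 1
  have h2 : f 2 = (k + 1) / 5 := hf 2
  have h3 : f 3 = (k + 2) / 5 := hf 3
  have h4 : f 4 = k / 5 := hf 4
  have h5 : f 5 = (k + 4) / 5 := hf 5
  have h6 : f 6 = (k + 3) / 5 := hf 6
  have h7 : f 7 = (k + 1) / 5 := hf 7
  constructor
  · intro v
    rw [sum_closedNeighborhood_circulantGraph_eight]
    obtain rfl | rfl | rfl | rfl | rfl | rfl | rfl | rfl :
        v = 0 ∨ v = 1 ∨ v = 2 ∨ v = 3 ∨ v = 4 ∨ v = 5 ∨ v = 6 ∨ v = 7 := by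
      revert v
      decide
    · change k ≤ f 6 + f 7 + f 0 + f 1 + f 2; omega
    · change k ≤ f 7 + f 0 + f 1 + f 2 + f 3; omega
    · change k ≤ f 0 + f 1 + f 2 + f 3 + f 4; omega
    · change k ≤ f 1 + f 2 + f 3 + f 4 + f 5; omega
    · change k ≤ f 2 + f 3 + f 4 + f 5 + f 6; omega
    · change k ≤ f 3 + f 4 + f 5 + f 6 + f 7; omega
    · change k ≤ f 4 + f 5 + f 6 + f 7 + f 0; omega
    · change k ≤ f 5 + f 6 + f 7 + f 0 + f 1; omega
  · have hsum : ∑ v, f v = f 0 + f 1 + f 2 + f 3 + f 4 + f 5 + f 6 + f 7 :=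
      Fin.sum_univ_eight f
    have hceil : ⌈(8 * k : ℚ) / 5⌉₊ = (8 * k + 4) / 5 := by
      apply eq_of_forall_ge_iff
      intro c
      rw [Nat.ceil_le, div_le_iff₀ (by norm_num)]
      norm_cast
      omega
    rw [hsum, hceil]
    have hmod : k % 5 = 0 ∨ k % 5 = 1 ∨ k % 5 = 2 ∨ k % 5 = 3 ∨ k % 5 = 4 := by omega
    rcases hmod with h | h | h | h | h <;> omega
end
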